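/- arXiv:2510.04505 — 5 statements merged into one kernel-verified Lean document; each statement's English description precedes it below -/
import Mathlib

section
/- Assume condition (C_g)(a) and let c > 0, d₂ > d₁ > c. Suppose that for some ω ∈ (1, ∞], the solution z^{d₂} satisfies z^{d₂}(t) < 1 for every t ∈ (1, ω). Then z^{d₁}(t) < z^{d₂}(t) for all t ∈ (1, ω). -/
open Real Set Filter Topology MeasureTheory

noncomputable section

/-- Condition `(C_g)(a)`: `g` maps `[0,∞)` into `[0,1]`, the restriction of `g` to `[0,1]`
is `C¹` with derivative `g'` (one-sided at the endpoints), `g = 0` on `(1,∞)`,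
`g 0 = g' 0 = 0`, `g 1 = 1`, and `g' ξ > g ξ / ξ` for all `ξ ∈ (0,1]`. -/
structure CgA (g g' : ℝ → ℝ) : Prop where
  maps_to : ∀ ξ : ℝ, 0 ≤ ξ → g ξ ∈ Icc (0:ℝ) 1
  hasDeriv : ∀ ξ ∈ Icc (0:ℝ) 1, HasDerivWithinAt g (g' ξ) (Icc (0:ℝ) 1) ξ
  derivCont : ContinuousOn g' (Icc (0:ℝ) 1)
  eq_zero : ∀ ξ : ℝ, 1 < ξ → g ξ = 0
  g_zero : g 0 = 0
  g'_zero : g' 0 = 0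
  g_one : g 1 = 1
  slope : ∀ ξ : ℝ, 0 < ξ → ξ ≤ 1 → g ξ / ξ < g' ξ

/-- `x` is a (nonnegative, continuous) solution on `ℝ` of the delay equation
`x'(t) = -a·x(t) + b·F(x(t-1))`, in integral form. -/
def IsSolR (a b : ℝ) (F x : ℝ → ℝ) : Prop :=
  Continuous x ∧ (∀ t : ℝ, 0 ≤ x t) ∧
    ∀ τ t : ℝ, τ < t →
      IntervalIntegrable (fun s => Real.exp (-a * (t - s)) * F (x (s - 1))) volume τ t ∧
      x t = Real.exp (-a * (t - τ)) * x τ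
          + b * ∫ s in τ..t, Real.exp (-a * (t - s)) * F (x (s - 1))

/-- `x` is a (nonnegative, continuous) solution on `[T₁ - 1, ∞)` of the delay equation
`x'(t) = -a·x(t) + b·F(x(t-1))`, in integral form (identity for `T₁ ≤ τ < t`). -/
def IsSolOn (a b : ℝ) (F : ℝ → ℝ) (T₁ : ℝ) (x : ℝ → ℝ) : Prop :=
  ContinuousOn x (Ici (T₁ - 1)) ∧ (∀ t : ℝ, T₁ - 1 ≤ t → 0 ≤ x t) ∧
    ∀ τ t : ℝ, T₁ ≤ τ → τ < t →
      IntervalIntegrable (fun s => Real.exp (-a * (t - s)) * F (x (s - 1))) volume τ t ∧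
      x t = Real.exp (-a * (t - τ)) * x τ
          + b * ∫ s in τ..t, Real.exp (-a * (t - s)) * F (x (s - 1))

/-- `z` is the solution of `(E_g)` on `[0,∞)` with initial segment `z t = e^{-c t}` on `[0,1]`. -/
def IsZSol (c d : ℝ) (g z : ℝ → ℝ) : Prop :=
  IsSolOn c d g 1 z ∧ ∀ t ∈ Icc (0:ℝ) 1, z t = Real.exp (-c * t)

/-- Condition `(C_{f_n})(a)(b)`: `a n → c`, `b n → d`, each `f n : [0,∞) → [0,1)` is `C¹`
with derivative `f' n`, `f n 0 = 0`, `f' n > 0` on `(0,1/2]`, the uniform closeness of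
`(f n, f' n)` to `(g, g')` away from `1`, and the smallness of
`sup_{[1+κ,∞)}|f' n| · (sup_{[0,∞)}|f' n|)^m`. -/
structure Cfn (c d : ℝ) (g g' : ℝ → ℝ) (a b : ℕ → ℝ) (f f' : ℕ → ℝ → ℝ) : Prop where
  a_pos : ∀ n, 0 < a n
  b_pos : ∀ n, 0 < b n
  a_lim : Tendsto a atTop (nhds c)
  b_lim : Tendsto b atTop (nhds d)
  maps_to : ∀ n, ∀ ξ : ℝ, 0 ≤ ξ → f n ξ ∈ Ico (0:ℝ) 1
  hasDeriv : ∀ n, ∀ ξ : ℝ, 0 ≤ ξ → HasDerivWithinAt (f n) (f' n ξ) (Ici (0:ℝ)) ξ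
  derivCont : ∀ n, ContinuousOn (f' n) (Ici (0:ℝ))
  f_zero : ∀ n, f n 0 = 0
  f'_pos : ∀ n, ∀ ξ : ℝ, 0 < ξ → ξ ≤ 1/2 → 0 < f' n ξ
  close : ∀ κ : ℝ, 0 < κ → κ < 1 → ∀ ε : ℝ, 0 < ε → ∃ N : ℕ, ∀ n ≥ N,
      ∀ ξ : ℝ, (ξ ∈ Icc (0:ℝ) (1 - κ) ∨ 1 + κ ≤ ξ) →
        |f n ξ - g ξ| + |f' n ξ - g' ξ| < ε
  small : ∀ κ : ℝ, 0 < κ → κ < 1 → ∀ m : ℕ, ∃ A B : ℕ → ℝ,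
      (∀ n, ∀ ξ : ℝ, 1 + κ ≤ ξ → |f' n ξ| ≤ A n) ∧
      (∀ n, ∀ ξ : ℝ, 0 ≤ ξ → |f' n ξ| ≤ B n) ∧
      Tendsto (fun n => A n * (B n) ^ m) atTop (nhds 0)

/-- Condition `(H)`. -/
structure CondH (a b ξm ξp : ℝ) (h : ℝ → ℝ) : Prop where
  a_pos : 0 < a
  b_pos : 0 < b
  ξm_neg : ξm < 0
  ξp_pos : 0 < ξp
  bdd : ∃ M : ℝ, ∀ ξ : ℝ, |h ξ| ≤ M
  smooth : ContDiff ℝ 1 h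
  h_zero : h 0 = 0
  slope_zero : a < b * deriv h 0
  zero_m : -a * ξm + b * h ξm = 0
  zero_p : -a * ξp + b * h ξp = 0
  ratio : ∀ ξ : ℝ, ξm < ξ → ξ < ξp → ξ ≠ 0 → a / b < h ξ / ξ
  deriv_pos : ∀ ξ : ℝ, ξ ≠ ξm → ξ ≠ ξp → 0 < deriv h ξ

/-- Solution of `(E_h)`: `u'(t) = -a·u(t) + b·h(u(t-1))` on all of `ℝ`. -/
def IsSolH (a b : ℝ) (h u : ℝ → ℝ) : Prop :=
  ∀ t : ℝ, HasDerivAt u (-a * u t + b * h (u (t - 1))) t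

/-- Solution of `(E_h)` on `[-1,∞)`: continuous there, differentiable on `(0,∞)`
and satisfying the equation for `t > 0`. -/
def IsSolHOn (a b : ℝ) (h u : ℝ → ℝ) : Prop :=
  ContinuousOn u (Ici (-1:ℝ)) ∧
    ∀ t : ℝ, 0 < t → HasDerivAt u (-a * u t + b * h (u (t - 1))) t

/-- Solution of `(E_h)` on `(-∞,0]`. -/
def IsSolHIic (a b : ℝ) (h u : ℝ → ℝ) : Prop :=
  ContinuousOn u (Iic (0:ℝ)) ∧
    ∀ t : ℝ, t ≤ 0 → HasDerivWithinAt u (-a * u t + b * h (u (t - 1))) (Iic (0:ℝ)) t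

/-- monotone ordering of the solutions `z^{d₁} < z^{d₂}` on `(1,ω)` as long
as `z^{d₂}` stays below `1` there. -/
theorem stmt_9 (c d₁ d₂ : ℝ) (g g' : ℝ → ℝ) (hg : CgA g g')
    (hc : 0 < c) (h1 : c < d₁) (h12 : d₁ < d₂)
    (z₁ z₂ : ℝ → ℝ) (hz₁ : IsZSol c d₁ g z₁) (hz₂ : IsZSol c d₂ g z₂)
    (ω : EReal) (hω : 1 < ω)
    (hlt : ∀ t : ℝ, 1 < t → (t : EReal) < ω → z₂ t < 1) :
    ∀ t : ℝ, 1 < t → (t : EReal) < ω → z₁ t < z₂ t := by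
  obtain ⟨⟨_, hn₁, hs₁⟩, hi₁⟩ := hz₁
  obtain ⟨⟨_, hn₂, hs₂⟩, hi₂⟩ := hz₂
  have hmono : StrictMonoOn g (Icc (0:ℝ) 1) := by
    apply strictMonoOn_of_deriv_pos (convex_Icc 0 1)
    · intro x hx
      exact (hg.hasDeriv x hx).continuousWithinAt
    · intro x hx
      rw [interior_Icc] at hx
      have hd := (hg.hasDeriv x ⟨hx.1.le, hx.2.le⟩).hasDerivAt (Icc_mem_nhds hx.1 hx.2)
      rw [hd.deriv]
      have := hg.slope x hx.1 hx.2.le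
      have h0 := div_nonneg (hg.maps_to x hx.1.le).1 hx.1.le
      linarith
  have hpos : ∀ t : ℝ, 0 ≤ t → 0 < z₂ t := by
    intro t ht
    rcases le_or_gt t 1 with h | h
    · rw [hi₂ t ⟨ht, h⟩]; positivity
    · rw [(hs₂ 1 t le_rfl h).2, hi₂ 1 ⟨zero_le_one, le_rfl⟩]
      have : 0 ≤ ∫ s in (1:ℝ)..t, Real.exp (-c * (t - s)) * g (z₂ (s - 1)) := by
        apply intervalIntegral.integral_nonneg h.le
        intro s hs
        have := (hg.maps_to _ (hn₂ (s - 1) (by linarith [hs.1]))).1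
        positivity
      have hd : 0 < d₂ := by linarith
      positivity
  have hle1 : ∀ t : ℝ, 0 ≤ t → (t : EReal) < ω → z₂ t ≤ 1 := by
    intro t ht htω
    rcases le_or_gt t 1 with h | h
    · rw [hi₂ t ⟨ht, h⟩, Real.exp_le_one_iff]; nlinarith
    · exact (hlt t h htω).le
  have step : ∀ t : ℝ, 1 < t → (t : EReal) < ω →
      (∀ s : ℝ, 0 ≤ s → s ≤ t - 1 → z₁ s ≤ z₂ s) → z₁ t < z₂ t := by
    intro t ht htω H
    have hsω : ∀ s : ℝ, s ≤ t → ((s - 1 : ℝ) : EReal) < ω := fun s hs =>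
      lt_of_le_of_lt (EReal.coe_le_coe_iff.2 (by linarith)) htω
    obtain ⟨I1, e1⟩ := hs₁ 1 t le_rfl ht
    obtain ⟨I2, e2⟩ := hs₂ 1 t le_rfl ht
    have hI : (∫ s in (1:ℝ)..t, Real.exp (-c * (t - s)) * g (z₁ (s - 1)))
        ≤ ∫ s in (1:ℝ)..t, Real.exp (-c * (t - s)) * g (z₂ (s - 1)) := by
      apply intervalIntegral.integral_mono_on ht.le I1 I2
      intro s hs
      have h0 : (0:ℝ) ≤ s - 1 := by linarith [hs.1]
      have ha := H (s - 1) h0 (by linarith [hs.2])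
      have hb := hle1 (s - 1) h0 (hsω s hs.2)
      have hz := hn₁ (s - 1) (by linarith)
      exact mul_le_mul_of_nonneg_left
        (hmono.monotoneOn ⟨hz, ha.trans hb⟩ ⟨hz.trans ha, hb⟩ ha) (Real.exp_pos _).le
    have hP : 0 < ∫ s in (1:ℝ)..t, Real.exp (-c * (t - s)) * g (z₂ (s - 1)) := by
      apply intervalIntegral.intervalIntegral_pos_of_pos_on I2 _ ht
      intro s hs
      have h0 : (0:ℝ) ≤ s - 1 := by linarith [hs.1]
      have hb := hle1 (s - 1) h0 (hsω s hs.2.le)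
      have hp := hpos (s - 1) h0
      have := hmono ⟨le_rfl, zero_le_one⟩ ⟨hp.le, hb⟩ hp
      rw [hg.g_zero] at this
      positivity
    rw [e1, e2, hi₁ 1 ⟨zero_le_one, le_rfl⟩, hi₂ 1 ⟨zero_le_one, le_rfl⟩]
    have hd : 0 ≤ d₁ := by linarith
    have q1 := mul_le_mul_of_nonneg_left hI hd
    have q2 := mul_lt_mul_of_pos_right h12 hP
    linarith
  have key : ∀ n : ℕ, ∀ t : ℝ, 0 ≤ t → t ≤ n + 1 → (t : EReal) < ω → z₁ t ≤ z₂ t := by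
    intro n
    induction n with
    | zero =>
      intro t h0 h1 _
      have h1 : t ≤ 1 := by simpa using h1
      rw [hi₁ t ⟨h0, h1⟩, hi₂ t ⟨h0, h1⟩]
    | succ n ih =>
      intro t h0 h1 hw
      push_cast at h1
      rcases le_or_gt t 1 with h | h
      · rw [hi₁ t ⟨h0, h⟩, hi₂ t ⟨h0, h⟩]
      · refine (step t h hw fun s hs0 hs1 => ih s hs0 (by linarith) ?_).le
        exact lt_of_le_of_lt (EReal.coe_le_coe_iff.2 (by linarith)) hw
  intro t ht hw
  obtain ⟨n, hn⟩ := exists_nat_ge t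
  refine step t ht hw fun s hs0 hs1 => key n s hs0 (by linarith) ?_
  exact lt_of_le_of_lt (EReal.coe_le_coe_iff.2 (by linarith)) hw
end
end

section
/- Assume condition (C_g)(a) and let c > 0. Let z^c : [0,∞) → ℝ be the solution of (E_g) with d = c and z^c(t) = e^{−c·t} for 0 ≤ t ≤ 1. Then 0 < z^c(t) < 1 for every t ≥ 1. -/
open Real Set Filter Topology MeasureTheory

noncomputable section

/-- the solution `z^c` (case `d = c`) satisfies `0 < z^c(t) < 1` for `t ≥ 1`. -/
theorem stmt_10 (c : ℝ) (g g' : ℝ → ℝ) (hg : CgA g g') (hc : 0 < c)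
    (z : ℝ → ℝ) (hz : IsZSol c c g z) :
    ∀ t : ℝ, 1 ≤ t → 0 < z t ∧ z t < 1 := by
  obtain ⟨⟨hcont, hnn, hint⟩, hinit⟩ := hz
  have h1 : z 1 = Real.exp (-c * 1) := hinit 1 (by constructor <;> norm_num)
  have hlt : z 1 < 1 := by
    rw [h1, Real.exp_lt_one_iff]; linarith
  have hpos : 0 < z 1 := by rw [h1]; exact Real.exp_pos _
  intro t ht
  rcases ht.eq_or_lt with rfl | ht'
  · exact ⟨hpos, hlt⟩
  obtain ⟨hi, he⟩ := hint 1 t le_rfl ht'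
  have hgb : ∀ s ∈ Icc (1:ℝ) t, g (z (s - 1)) ∈ Icc (0:ℝ) 1 := fun s hs =>
    hg.maps_to _ (hnn _ (by linarith [hs.1]))
  have hge : 0 ≤ ∫ s in (1:ℝ)..t, Real.exp (-c * (t - s)) * g (z (s - 1)) :=
    intervalIntegral.integral_nonneg ht fun s hs =>
      mul_nonneg (Real.exp_pos _).le (hgb s hs).1
  have hcE : Continuous (fun s : ℝ => Real.exp (-c * (t - s))) := by fun_prop
  have hle : ∫ s in (1:ℝ)..t, Real.exp (-c * (t - s)) * g (z (s - 1)) ≤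
      ∫ s in (1:ℝ)..t, Real.exp (-c * (t - s)) :=
    intervalIntegral.integral_mono_on ht hi (hcE.intervalIntegrable _ _) fun s hs =>
      mul_le_of_le_one_right (Real.exp_pos _).le (hgb s hs).2
  have hE : c * ∫ s in (1:ℝ)..t, Real.exp (-c * (t - s)) = 1 - Real.exp (-c * (t - 1)) := by
    rw [← intervalIntegral.integral_const_mul]
    rw [intervalIntegral.integral_eq_sub_of_hasDerivAt
      (f := fun s => Real.exp (-c * (t - s)))]
    · simp
    · intro s _
      have h : HasDerivAt (fun s => Real.exp (-c * (t - s)))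
          (Real.exp (-c * (t - s)) * (-c * (-1))) s :=
        (((hasDerivAt_id' s).const_sub t).const_mul (-c)).exp
      exact h.congr_deriv (by ring)
    · exact (continuous_const.mul hcE).intervalIntegrable _ _
  have hx := Real.exp_pos (-c * (t - 1))
  have hm := mul_le_mul_of_nonneg_left hle hc.le
  have hm0 := mul_nonneg hc.le hge
  have hp := mul_pos hx hpos
  have hq := mul_lt_mul_of_pos_left hlt hx
  constructor
  · linarith
  · linarith
end
end

section
/- Assume condition (C_g)(a) and let c > 0. Define D := { d > c : z^d(t) < 1 for all t > 0, and z^d(t) → 0 as t → ∞ }. Then there exists a critical parameter value d* > c such that D = (c, d*). -/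
open Real Set Filter Topology MeasureTheory

noncomputable section

theorem aux_ratio {g g' : ℝ → ℝ} (hg : CgA g g') :
    StrictMonoOn (fun ξ => g ξ / ξ) (Ioc (0:ℝ) 1) := by
  apply strictMonoOn_of_deriv_pos (convex_Ioc 0 1)
  · apply ContinuousOn.div
    · exact fun x hx => ((hg.hasDeriv x (Ioc_subset_Icc_self hx)).continuousWithinAt).mono
        Ioc_subset_Icc_self
    · exact continuousOn_id
    · exact fun x hx => hx.1.ne'
  · intro x hx
    rw [interior_Ioc] at hx
    have h1 : HasDerivAt g (g' x) x :=
      (hg.hasDeriv x (Ioo_subset_Icc_self hx)).hasDerivAt (Icc_mem_nhds hx.1 hx.2)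
    have h2 := h1.div (hasDerivAt_id x) hx.1.ne'
    have h3 : deriv (fun ξ => g ξ / ξ) x = (g' x * id x - g x * 1) / id x ^ 2 := h2.deriv
    rw [h3]
    have h4 := hg.slope x hx.1 hx.2.le
    rw [div_lt_iff₀ hx.1] at h4
    have := hx.1
    apply div_pos
    · simp only [id]; linarith
    · simp only [id]; positivity

theorem aux_le {g g' : ℝ → ℝ} (hg : CgA g g') {a b : ℝ} (ha : 0 ≤ a) (hab : a ≤ b)
    (hb0 : 0 < b) (hb : b ≤ 1) : g a ≤ g b / b * a := by
  rcases ha.eq_or_lt with rfl | ha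
  · simp [hg.g_zero]
  · have := (aux_ratio hg).monotoneOn ⟨ha, hab.trans hb⟩ ⟨hb0, hb⟩ hab
    rwa [div_le_iff₀ ha] at this

theorem aux_mono {g g' : ℝ → ℝ} (hg : CgA g g') {a b : ℝ} (ha : 0 ≤ a) (hab : a ≤ b)
    (hb : b ≤ 1) : g a ≤ g b := by
  rcases (ha.trans hab).eq_or_lt with h0 | hb0
  · have : a = b := by linarith
    rw [this]
  · refine (aux_le hg ha hab hb0 hb).trans ?_
    have h := (hg.maps_to b hb0.le).1
    rw [div_mul_eq_mul_div, div_le_iff₀ hb0]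
    exact mul_le_mul_of_nonneg_left hab h

theorem aux_lt_self {g g' : ℝ → ℝ} (hg : CgA g g') {a : ℝ} (ha : 0 < a) (ha1 : a < 1) :
    g a < a := by
  have := aux_ratio hg ⟨ha, ha1.le⟩ ⟨one_pos, le_rfl⟩ ha1
  simp only [hg.g_one] at this
  rw [div_lt_iff₀ ha] at this
  linarith

theorem aux_pos {g g' : ℝ → ℝ} (hg : CgA g g') {a : ℝ} (ha : 0 < a) (ha1 : a ≤ 1) :
    0 < g a := by
  have := aux_ratio hg (a := a/2) (b := a) ⟨by linarith, by linarith⟩ ⟨ha, ha1⟩ (by linarith)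
  have h2 : 0 ≤ g (a/2) / (a/2) := div_nonneg (hg.maps_to _ (by linarith)).1 (by linarith)
  have h3 : 0 < g a / a := lt_of_le_of_lt h2 this
  exact (div_pos_iff_of_pos_right ha).1 h3

theorem aux_small {g g' : ℝ → ℝ} (hg : CgA g g') {ε : ℝ} (hε : 0 < ε) :
    ∃ q, 0 < q ∧ q < 1 ∧ g q < ε * q := by
  have h := hg.hasDeriv 0 ⟨le_rfl, zero_le_one⟩
  rw [hg.g'_zero, hasDerivWithinAt_iff_isLittleO] at h
  have h1 := h.def (half_pos hε)
  have h2 : 𝓝[>] (0:ℝ) ≤ 𝓝[Icc 0 1] 0 := by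
    apply nhdsWithin_le_of_mem
    exact Icc_mem_nhdsGT one_pos
  have h3 := h1.filter_mono h2
  have h4 : Ioo (0:ℝ) 1 ∈ 𝓝[>] (0:ℝ) := Ioo_mem_nhdsGT one_pos
  obtain ⟨q, hq, hq'⟩ := (h3.and h4).exists
  refine ⟨q, hq'.1, hq'.2, ?_⟩
  simp only [hg.g_zero, sub_zero, smul_zero, Real.norm_eq_abs, abs_of_pos hq'.1] at hq
  have := le_abs_self (g q)
  nlinarith [hq'.1]

theorem aux_expint {c : ℝ} (hc : 0 < c) (τ t : ℝ) :
    ∫ s in τ..t, Real.exp (-c * (t - s)) = (1 - Real.exp (-c * (t - τ))) / c := by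
  have h : ∀ s ∈ uIcc τ t, HasDerivAt (fun s => Real.exp (-c * (t - s)) / c)
      (Real.exp (-c * (t - s))) s := by
    intro s _
    have h1 : HasDerivAt (fun s : ℝ => -c * (t - s)) c s := by
      have := ((hasDerivAt_id s).const_sub t).const_mul (-c)
      simpa using this
    have h2 := h1.exp.div_const c
    rwa [mul_div_cancel_right₀ _ hc.ne'] at h2
  rw [intervalIntegral.integral_eq_sub_of_hasDerivAt h]
  · simp; ring
  · apply Continuous.intervalIntegrable; fun_prop

/-- one-step bound -/
theorem aux_step {c d : ℝ} {g z : ℝ → ℝ} (hc : 0 < c) (hd : 0 < d) (hz : IsZSol c d g z)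
    {τ t H : ℝ} (hτ : 1 ≤ τ) (ht : τ < t) (hH : ∀ s ∈ Icc τ t, g (z (s-1)) ≤ H) :
    z t ≤ Real.exp (-c * (t - τ)) * z τ + d * H * ((1 - Real.exp (-c * (t - τ))) / c) := by
  obtain ⟨hi, he⟩ := hz.1.2.2 τ t hτ ht
  rw [he, ← aux_expint hc τ t, mul_assoc, ← intervalIntegral.integral_const_mul H]
  gcongr
  apply intervalIntegral.integral_mono_on ht.le hi
  · apply Continuous.intervalIntegrable; fun_prop
  · intro s hs
    rw [mul_comm H]
    exact mul_le_mul_of_nonneg_left (hH s hs) (Real.exp_pos _).le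

theorem aux_stay {c d : ℝ} {g g' z : ℝ → ℝ} (hg : CgA g g') (hc : 0 < c) (hd : 0 < d)
    (hz : IsZSol c d g z) {q M a : ℝ} (ha : 0 ≤ a) (hq0 : 0 < q) (hq1 : q < 1)
    (hq : d * g q < c * q) (hM0 : 0 < M) (hM : M ≤ q) (h : ∀ t ∈ Icc a (a+1), z t ≤ M) :
    ∀ t, a ≤ t → z t ≤ M := by
  have hk : ∀ n : ℕ, ∀ t ∈ Icc a (a+1+n), z t ≤ M := by
    intro n
    induction n with
    | zero => simpa using h
    | succ n ih =>
      intro t ht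
      push_cast at ht
      rcases le_or_gt t (a+1) with h1 | h1
      · exact h t ⟨ht.1, h1⟩
      · have := aux_step hc hd hz (τ := a+1) (t := t) (H := g q / q * M) (by linarith) h1 (by
          intro s hs
          have hzs : z (s-1) ≤ M := ih _ ⟨by linarith [hs.1], by linarith [hs.2, ht.2]⟩
          have hz0 : 0 ≤ z (s-1) := hz.1.2.1 _ (by linarith [hs.1])
          refine (aux_le hg hz0 (hzs.trans hM) hq0 hq1.le).trans ?_
          exact mul_le_mul_of_nonneg_left hzs
            (div_nonneg (hg.maps_to q hq0.le).1 hq0.le))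
        have hza : z (a+1) ≤ M := h _ ⟨by linarith, le_rfl⟩
        have he : Real.exp (-c * (t - (a+1))) ≤ 1 := by
          apply Real.exp_le_one_iff.2; nlinarith
        have he0 := Real.exp_pos (-c * (t - (a+1)))
        set e := Real.exp (-c * (t - (a+1)))
        have hr : d * (g q / q * M) ≤ c * M := by
          have : d * (g q / q) ≤ c := by
            rw [← mul_div_assoc, div_le_iff₀ hq0]; exact hq.le
          nlinarith
        have h5 : d * (g q / q * M) * ((1 - e) / c) ≤ c * M * ((1 - e)/c) :=
          mul_le_mul_of_nonneg_right hr (div_nonneg (by linarith) hc.le)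
        have h6 : c * M * ((1 - e)/c) = M * (1 - e) := by field_simp
        nlinarith
  intro t ht
  obtain ⟨n, hn⟩ := exists_nat_ge (t - (a+1))
  exact hk n t ⟨ht, by linarith⟩

theorem aux_decay {c d : ℝ} {g g' z : ℝ → ℝ} (hg : CgA g g') (hc : 0 < c) (hd : 0 < d)
    (hz : IsZSol c d g z) {q a : ℝ} (ha : 0 ≤ a) (hq0 : 0 < q) (hq1 : q < 1)
    (hq : d * g q < c * q) (h : ∀ t ∈ Icc a (a+1), z t ≤ q) :
    Tendsto z atTop (𝓝 0) := by
  obtain ⟨ρ, hρ⟩ : ∃ ρ, ρ = d * g q / (c * q) := ⟨_, rfl⟩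
  have hgq := (hg.maps_to q hq0.le).1
  have hρ0 : 0 ≤ ρ := by rw [hρ]; positivity
  have hρ1 : ρ < 1 := by rw [hρ, div_lt_one (by positivity)]; exact hq
  have hc1 : Real.exp (-c) < 1 := by rw [Real.exp_lt_one_iff]; linarith
  have hc0 := Real.exp_pos (-c)
  obtain ⟨κ, hκ⟩ : ∃ κ, κ = ρ + (1 - ρ) * Real.exp (-c) := ⟨_, rfl⟩
  have hκ1 : κ < 1 := by nlinarith
  have hκ0 : 0 < κ := by nlinarith
  have key : ∀ n : ℕ, ∀ t, a + 2 * n ≤ t → z t ≤ κ ^ n * q := by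
    intro n
    induction n with
    | zero =>
      intro t ht
      simp only [pow_zero, one_mul]
      exact aux_stay hg hc hd hz ha hq0 hq1 hq hq0 le_rfl h t (by simpa using ht)
    | succ n ih =>
      intro t ht
      push_cast at ht
      obtain ⟨M, hM⟩ : ∃ M, M = κ ^ n * q := ⟨_, rfl⟩
      rw [← hM] at ih
      have hM0 : 0 < M := by rw [hM]; positivity
      have hMq : M ≤ q := by
        rw [hM]; exact mul_le_of_le_one_left hq0.le (pow_le_one₀ hκ0.le hκ1.le)
      have hn0 : (0:ℝ) ≤ n := Nat.cast_nonneg n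
      have := aux_step hc hd hz (τ := a+2*n+1) (t := t) (H := g q / q * M) (by linarith)
        (by linarith) (by
          intro s hs
          have hzs : z (s-1) ≤ M := ih _ (by linarith [hs.1])
          have hz0 : 0 ≤ z (s-1) := hz.1.2.1 _ (by linarith [hs.1])
          refine (aux_le hg hz0 (hzs.trans hMq) hq0 hq1.le).trans ?_
          exact mul_le_mul_of_nonneg_left hzs (div_nonneg hgq hq0.le))
      have hza : z (a+2*n+1) ≤ M := ih _ (by linarith)
      have he : Real.exp (-c * (t - (a+2*n+1))) ≤ Real.exp (-c) := by
        apply Real.exp_le_exp.2; nlinarith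
      have he0 := Real.exp_pos (-c * (t - (a+2*n+1)))
      set e := Real.exp (-c * (t - (a+2*n+1)))
      have h6 : d * (g q / q * M) * ((1 - e)/c) = ρ * M * (1 - e) := by
        rw [hρ]; field_simp
      rw [h6] at this
      have h7 : z t ≤ M * (ρ + (1-ρ) * e) := by nlinarith
      have h8 : M * (ρ + (1-ρ) * e) ≤ M * κ := by
        rw [hκ]; gcongr
      rw [pow_succ]
      calc z t ≤ M * κ := h7.trans h8
        _ = κ ^ n * κ * q := by rw [hM]; ring
  rw [Metric.tendsto_atTop]
  intro ε hε
  have hl : Tendsto (fun n : ℕ => κ ^ n * q) atTop (𝓝 (0 * q)) :=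
    (tendsto_pow_atTop_nhds_zero_of_lt_one hκ0.le hκ1).mul_const q
  rw [zero_mul] at hl
  obtain ⟨n, hn⟩ := (hl.eventually (gt_mem_nhds hε)).exists
  refine ⟨a + 2 * n, fun t ht => ?_⟩
  have hn0 : (0:ℝ) ≤ n := Nat.cast_nonneg n
  have hz0 : 0 ≤ z t := hz.1.2.1 _ (by linarith)
  rw [Real.dist_eq, sub_zero, abs_of_nonneg hz0]
  exact (key n t ht).trans_lt hn

theorem aux_compare {c d₁ d₂ : ℝ} {g g' z₁ z₂ : ℝ → ℝ} (hg : CgA g g') (hd : 0 < d₁)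
    (hd2 : d₁ ≤ d₂) (h₁ : IsZSol c d₁ g z₁) (h₂ : IsZSol c d₂ g z₂)
    (hlt : ∀ t, 0 < t → z₂ t < 1) : ∀ t, 0 ≤ t → z₁ t ≤ z₂ t := by
  have hle : ∀ t, 0 ≤ t → z₂ t ≤ 1 := by
    intro t ht
    rcases ht.eq_or_lt with rfl | ht
    · rw [h₂.2 0 ⟨le_rfl, zero_le_one⟩]; simp
    · exact (hlt t ht).le
  have hk : ∀ n : ℕ, ∀ t ∈ Icc (0:ℝ) (n+1), z₁ t ≤ z₂ t := by
    intro n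
    induction n with
    | zero =>
      intro t ht
      have ht' : t ∈ Icc (0:ℝ) 1 := by simpa using ht
      rw [h₁.2 t ht', h₂.2 t ht']
    | succ n ih =>
      intro t ht
      push_cast at ht
      rcases le_or_gt t 1 with h1 | h1
      · rw [h₁.2 t ⟨ht.1, h1⟩, h₂.2 t ⟨ht.1, h1⟩]
      · obtain ⟨i1, e1⟩ := h₁.1.2.2 1 t le_rfl h1
        obtain ⟨i2, e2⟩ := h₂.1.2.2 1 t le_rfl h1
        rw [e1, e2, h₁.2 1 ⟨zero_le_one, le_rfl⟩, h₂.2 1 ⟨zero_le_one, le_rfl⟩,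
          ← intervalIntegral.integral_const_mul, ← intervalIntegral.integral_const_mul]
        gcongr
        apply intervalIntegral.integral_mono_on h1.le (i1.const_mul _) (i2.const_mul _)
        intro s hs
        have hs0 : 0 ≤ s - 1 := by linarith [hs.1]
        have hz1 : 0 ≤ z₁ (s-1) := h₁.1.2.1 _ (by linarith)
        have hz2 : 0 ≤ z₂ (s-1) := h₂.1.2.1 _ (by linarith)
        have hm := aux_mono hg hz1 (ih (s-1) ⟨hs0, by linarith [hs.2, ht.2]⟩) (hle _ hs0)
        have := (hg.maps_to _ hz1).1
        gcongr
        linarith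
  intro t ht
  obtain ⟨n, hn⟩ := exists_nat_ge t
  exact hk n t ⟨ht, by linarith⟩

theorem aux_max {c d : ℝ} {g z : ℝ → ℝ} (hz : IsZSol c d g z)
    (hlt : ∀ t, 0 < t → z t < 1) (n : ℕ) : ∃ m < 1, ∀ t ∈ Icc (1:ℝ) (n+1), z t ≤ m := by
  have hc : ContinuousOn z (Icc (1:ℝ) (n+1)) := hz.1.1.mono (fun t ht => by
    simp only [sub_self, mem_Ici]; linarith [ht.1])
  obtain ⟨x, hx, hm⟩ := isCompact_Icc.exists_isMaxOn
    (nonempty_Icc.2 (by linarith [(Nat.cast_nonneg n : (0:ℝ) ≤ n)])) hc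
  exact ⟨z x, hlt x (by linarith [hx.1]), fun t ht => hm ht⟩

theorem aux_dep {c d : ℝ} {g g' : ℝ → ℝ} (hg : CgA g g') (hc : 0 < c) (hd : c < d)
    {z : ℝ → ℝ → ℝ} (hz : ∀ d : ℝ, c < d → IsZSol c d g (z d))
    (hlt : ∀ t, 0 < t → z d t < 1) (n : ℕ) : ∀ ε > 0, ∃ δ > 0, ∀ d', d < d' → d' < d + δ →
      ∀ t ∈ Icc (0:ℝ) (n+1), z d' t ≤ z d t + ε := by
  have hx := hz d hd
  induction n with
  | zero =>
    intro ε hε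
    refine ⟨1, one_pos, fun d' h1 h2 t ht => ?_⟩
    have ht' : t ∈ Icc (0:ℝ) 1 := by simpa using ht
    rw [hx.2 t ht', (hz d' (hd.trans h1)).2 t ht']
    linarith
  | succ n ih =>
    intro ε hε
    obtain ⟨m, hm1, hm⟩ := aux_max hx hlt n
    have hgc : ContinuousOn g (Icc (0:ℝ) 1) := fun x hx => (hg.hasDeriv x hx).continuousWithinAt
    have hu := isCompact_Icc.uniformContinuousOn_of_continuous hgc
    rw [Metric.uniformContinuousOn_iff] at hu
    have hd0 : 0 < d := hc.trans hd
    have hn0 : (0:ℝ) ≤ n := Nat.cast_nonneg n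
    obtain ⟨ε₂, hε₂⟩ : ∃ e, e = ε / (2 * (n+1) * d) := ⟨_, rfl⟩
    obtain ⟨δ₂, hδ₂⟩ : ∃ e, e = ε / (2 * (n+1)) := ⟨_, rfl⟩
    have hε₂0 : 0 < ε₂ := by rw [hε₂]; positivity
    have hδ₂0 : 0 < δ₂ := by rw [hδ₂]; positivity
    obtain ⟨η, hη, hu⟩ := hu ε₂ hε₂0
    obtain ⟨δ, hδ, ih⟩ := ih (min (η/2) (1 - m)) (lt_min (by linarith) (by linarith))
    refine ⟨min δ δ₂, lt_min hδ hδ₂0, fun d' h1 h2 t ht => ?_⟩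
    have hy := hz d' (hd.trans h1)
    push_cast at ht
    rcases le_or_gt t 1 with ht1 | ht1
    · rw [hx.2 t ⟨ht.1, ht1⟩, hy.2 t ⟨ht.1, ht1⟩]
      linarith
    have hd'1 : d' < d + δ := h2.trans_le (by gcongr; exact min_le_left _ _)
    have hd'2 : d' < d + δ₂ := h2.trans_le (by gcongr; exact min_le_right _ _)
    have hgle : ∀ s ∈ Icc (1:ℝ) t, g (z d' (s-1)) ≤ g (z d (s-1)) + ε₂ := by
      intro s hs
      rcases le_or_gt s 2 with hs2 | hs2
      · rw [hx.2 (s-1) ⟨by linarith [hs.1], by linarith⟩,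
          hy.2 (s-1) ⟨by linarith [hs.1], by linarith⟩]
        linarith
      · have h3 := ih d' h1 hd'1 (s-1) ⟨by linarith, by linarith [hs.2, ht.2]⟩
        have h4 := hm (s-1) ⟨by linarith, by linarith [hs.2, ht.2]⟩
        have h5 : 0 ≤ z d (s-1) := hx.1.2.1 _ (by linarith)
        have h6 : 0 ≤ z d' (s-1) := hy.1.2.1 _ (by linarith)
        have h7 := min_le_left (η/2) (1-m)
        have h8 := min_le_right (η/2) (1-m)
        rcases le_or_gt (z d' (s-1)) (z d (s-1)) with h9 | h9
        · have := aux_mono hg h6 h9 (by linarith)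
          linarith
        · have := hu (z d' (s-1)) ⟨h6, by linarith⟩ (z d (s-1)) ⟨h5, by linarith⟩ (by
            rw [Real.dist_eq, abs_of_pos (by linarith)]; linarith)
          rw [Real.dist_eq] at this
          linarith [le_abs_self (g (z d' (s-1)) - g (z d (s-1)))]
    obtain ⟨i1, e1⟩ := hx.1.2.2 1 t le_rfl ht1
    obtain ⟨i2, e2⟩ := hy.1.2.2 1 t le_rfl ht1
    have hint : d' * (∫ s in (1:ℝ)..t, Real.exp (-c * (t - s)) * g (z d' (s - 1))) ≤
        d * (∫ s in (1:ℝ)..t, Real.exp (-c * (t - s)) * g (z d (s - 1)))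
          + (t - 1) * (δ₂ + d * ε₂) := by
      have hcst : (t - 1) * (δ₂ + d * ε₂) = ∫ s in (1:ℝ)..t, (δ₂ + d * ε₂) := by
        rw [intervalIntegral.integral_const, smul_eq_mul]
      rw [hcst, ← intervalIntegral.integral_const_mul, ← intervalIntegral.integral_const_mul,
        ← intervalIntegral.integral_add (i1.const_mul _) (by simp)]
      apply intervalIntegral.integral_mono_on ht1.le (i2.const_mul _)
        ((i1.const_mul _).add (by simp))
      intro s hs
      have h3 := hgle s hs
      have h6 : 0 ≤ z d' (s-1) := hy.1.2.1 _ (by linarith [hs.1])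
      have h7 := hg.maps_to _ h6
      have he : Real.exp (-c * (t - s)) ≤ 1 := by
        apply Real.exp_le_one_iff.2; nlinarith [hs.2]
      have he0 := Real.exp_pos (-c * (t - s))
      set e := Real.exp (-c * (t - s))
      have h8 : d' * g (z d' (s-1)) ≤ d * g (z d (s-1)) + (δ₂ + d * ε₂) := by
        have : (d' - d) * g (z d' (s-1)) ≤ δ₂ * 1 :=
          mul_le_mul (by linarith) h7.2 h7.1 hδ₂0.le
        have := mul_le_mul_of_nonneg_left h3 hd0.le
        nlinarith
      have h9 : 0 < δ₂ + d * ε₂ := by positivity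
      have h10 := mul_le_mul_of_nonneg_left h8 he0.le
      have h11 : e * (δ₂ + d * ε₂) ≤ 1 * (δ₂ + d * ε₂) := mul_le_mul_of_nonneg_right he h9.le
      linarith
    have hf : (t - 1) * (δ₂ + d * ε₂) ≤ ε := by
      have h9 : 0 < δ₂ + d * ε₂ := by positivity
      have : (n + 1) * (δ₂ + d * ε₂) = ε := by
        rw [hδ₂, hε₂]; field_simp; norm_num
      rw [← this]
      apply mul_le_mul_of_nonneg_right _ h9.le
      linarith [ht.2]
    rw [e1, e2, hx.2 1 ⟨zero_le_one, le_rfl⟩, hy.2 1 ⟨zero_le_one, le_rfl⟩]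
    linarith

theorem aux_bdd {c d : ℝ} {g g' z : ℝ → ℝ} (hg : CgA g g') (hc : 0 < c) (hd : 0 < d)
    (hz : IsZSol c d g z) : d * (Real.exp (-c) * g (Real.exp (-c))) ≤ z 2 := by
  obtain ⟨i, e⟩ := hz.1.2.2 1 2 le_rfl (by norm_num)
  have h0 : 0 ≤ z 1 := hz.1.2.1 _ (by norm_num)
  have h1 : Real.exp (-c) * g (Real.exp (-c)) ≤
      ∫ s in (1:ℝ)..2, Real.exp (-c * (2 - s)) * g (z (s - 1)) := by
    have : Real.exp (-c) * g (Real.exp (-c)) =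
      ∫ s in (1:ℝ)..2, Real.exp (-c) * g (Real.exp (-c)) := by
        rw [intervalIntegral.integral_const]; norm_num
    rw [this]
    apply intervalIntegral.integral_mono_on (by norm_num) (by simp) i
    intro s hs
    rw [hz.2 (s-1) ⟨by linarith [hs.1], by linarith [hs.2]⟩]
    have h2 := aux_mono hg (Real.exp_pos (-c)).le (b := Real.exp (-c * (s-1)))
      (Real.exp_le_exp.2 (by nlinarith [hs.2])) (Real.exp_le_one_iff.2 (by nlinarith [hs.1]))
    have h3 := (hg.maps_to _ (Real.exp_pos (-c)).le).1
    apply mul_le_mul _ h2 h3 (Real.exp_pos _).le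
    exact Real.exp_le_exp.2 (by nlinarith [hs.1])
  rw [e]
  have := mul_le_mul_of_nonneg_left h1 hd.le
  have h4 : 0 ≤ Real.exp (-c * (2 - 1)) * z 1 := by positivity
  linarith

theorem aux_first {c d : ℝ} {g g' z : ℝ → ℝ} (hg : CgA g g') (hc : 0 < c) (hd : c < d)
    (hz : IsZSol c d g z) : ∀ t ∈ Icc (1:ℝ) 2,
      z t ≤ 1 - Real.exp (-c) * (1 - Real.exp (-c)) + (d - c) := by
  have hc1 : Real.exp (-c) < 1 := by rw [Real.exp_lt_one_iff]; linarith
  have hc0 := Real.exp_pos (-c)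
  have hz1 : z 1 = Real.exp (-c) := by
    rw [hz.2 1 ⟨zero_le_one, le_rfl⟩]; simp
  intro t ht
  rcases ht.1.eq_or_lt with rfl | h1
  · rw [hz1]; nlinarith
  obtain ⟨i, e⟩ := hz.1.2.2 1 t le_rfl h1
  have hI : ∫ s in (1:ℝ)..t, Real.exp (-c * (t - s)) * g (z (s - 1)) ≤
      (t - 1) * Real.exp (-c * (t-1)) := by
    have : (t - 1) * Real.exp (-c * (t-1)) = ∫ s in (1:ℝ)..t, Real.exp (-c * (t-1)) := by
      rw [intervalIntegral.integral_const]; simp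
    rw [this]
    apply intervalIntegral.integral_mono_on h1.le i (by simp)
    intro s hs
    have hs' : s - 1 ∈ Icc (0:ℝ) 1 := ⟨by linarith [hs.1], by linarith [hs.2, ht.2]⟩
    rw [hz.2 (s-1) hs']
    have h2 : g (Real.exp (-c * (s-1))) ≤ Real.exp (-c * (s-1)) := by
      have := aux_le hg (Real.exp_pos (-c * (s-1))).le (b := 1)
        (Real.exp_le_one_iff.2 (by nlinarith [hs.1])) one_pos le_rfl
      simpa [hg.g_one] using this
    calc _ ≤ Real.exp (-c * (t - s)) * Real.exp (-c * (s-1)) :=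
          mul_le_mul_of_nonneg_left h2 (Real.exp_pos _).le
      _ = _ := by rw [← Real.exp_add]; congr 1; ring
  have he1 : Real.exp (-c * (t-1)) * (1 + c * (t-1)) ≤ 1 := by
    have h3 : 1 + c * (t-1) ≤ Real.exp (c * (t-1)) := by
      linarith [Real.add_one_le_exp (c * (t-1))]
    calc _ ≤ Real.exp (-c * (t-1)) * Real.exp (c * (t-1)) :=
          mul_le_mul_of_nonneg_left h3 (Real.exp_pos _).le
      _ = 1 := by rw [← Real.exp_add]; simp
  have he2 : Real.exp (-c) ≤ Real.exp (-c * (t-1)) :=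
    Real.exp_le_exp.2 (by nlinarith [ht.2])
  have he3 : Real.exp (-c * (t-1)) ≤ 1 := Real.exp_le_one_iff.2 (by nlinarith)
  have hd0 : 0 < d := hc.trans hd
  have hI2 := mul_le_mul_of_nonneg_left hI hd0.le
  have he0 := Real.exp_pos (-c * (t-1))
  rw [e, hz1]
  set E := Real.exp (-c * (t-1))
  set F := Real.exp (-c)
  have h4 : (t - 1) * E ≤ 1 := by
    have := mul_le_mul (show t - 1 ≤ 1 by linarith [ht.2]) he3 he0.le zero_le_one
    linarith
  have h5 : (d - c) * ((t-1) * E) ≤ (d - c) * 1 :=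
    mul_le_mul_of_nonneg_left h4 (by linarith)
  have h6 : F * (1 - F) ≤ E * (1 - F) := mul_le_mul_of_nonneg_right he2 (by linarith)
  nlinarith

/-- the set `D` of parameters `d > c` for which `z^d` stays below `1` and
tends to `0` is an interval `(c, d*)` for some critical value `d* > c`. -/
theorem stmt_11 (c : ℝ) (g g' : ℝ → ℝ) (hg : CgA g g') (hc : 0 < c)
    (z : ℝ → ℝ → ℝ) (hz : ∀ d : ℝ, c < d → IsZSol c d g (z d)) :
    ∃ dstar : ℝ, c < dstar ∧
      {d : ℝ | c < d ∧ (∀ t : ℝ, 0 < t → z d t < 1) ∧ Tendsto (z d) atTop (nhds 0)}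
        = Ioo c dstar := by
  have hc1 : Real.exp (-c) < 1 := by rw [Real.exp_lt_one_iff]; linarith
  have hc0 := Real.exp_pos (-c)
  set D := {d : ℝ | c < d ∧ (∀ t : ℝ, 0 < t → z d t < 1) ∧ Tendsto (z d) atTop (nhds 0)} with hD
  -- nonempty
  have hne : D.Nonempty := by
    obtain ⟨r, hr⟩ : ∃ r, r = Real.exp (-c) * (1 - Real.exp (-c)) := ⟨_, rfl⟩
    have hr0 : 0 < r := by rw [hr]; exact mul_pos hc0 (by linarith)
    have hr1 : r < 1 := by rw [hr]; nlinarith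
    obtain ⟨q, hq⟩ : ∃ q, q = 1 - r / 2 := ⟨_, rfl⟩
    have hq0 : 0 < q := by linarith
    have hq1 : q < 1 := by linarith
    have hgq := aux_lt_self hg hq0 hq1
    have hgq0 := aux_pos hg hq0 hq1.le
    obtain ⟨δ, hδ⟩ : ∃ δ, δ = min (r/2) (c * (q - g q) / 2) := ⟨_, rfl⟩
    have hδ0 : 0 < δ := by
      rw [hδ]; exact lt_min (by linarith) (by have := mul_pos hc (sub_pos.2 hgq); linarith)
    have hδ1 : δ ≤ r / 2 := hδ ▸ min_le_left _ _
    have hδ2 : δ ≤ c * (q - g q) / 2 := hδ ▸ min_le_right _ _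
    have hdc : c < c + δ := by linarith
    have hsol := hz _ hdc
    have hdg : (c + δ) * g q < c * q := by
      have : δ * g q ≤ δ * 1 := mul_le_mul_of_nonneg_left (by linarith) hδ0.le
      nlinarith
    have hf : ∀ t ∈ Icc (1:ℝ) (1+1), z (c + δ) t ≤ q := by
      intro t ht
      have := aux_first hg hc hdc hsol t ⟨ht.1, by linarith [ht.2]⟩
      rw [← hr] at this
      linarith
    have hd0 : 0 < c + δ := by linarith
    refine ⟨c + δ, hdc, fun t ht => ?_, aux_decay hg hc hd0 hsol zero_le_one hq0 hq1 hdg hf⟩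
    rcases le_or_gt t 1 with h1 | h1
    · rw [hsol.2 t ⟨ht.le, h1⟩, Real.exp_lt_one_iff]; nlinarith
    · exact (aux_stay hg hc hd0 hsol zero_le_one hq0 hq1 hdg hq0 le_rfl hf t h1.le).trans_lt hq1
  -- bounded
  have hbdd : BddAbove D := by
    have hp : 0 < Real.exp (-c) * g (Real.exp (-c)) := mul_pos hc0 (aux_pos hg hc0 hc1.le)
    refine ⟨1 / (Real.exp (-c) * g (Real.exp (-c))), fun d hd => ?_⟩
    rw [le_div_iff₀ hp]
    exact (aux_bdd hg hc (hc.trans hd.1) (hz d hd.1)).trans (hd.2.1 2 (by norm_num)).le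
  -- downward closed
  have hdown : ∀ d ∈ D, ∀ d', c < d' → d' ≤ d → d' ∈ D := by
    intro d hd d' h1 h2
    have hcmp := aux_compare hg (hc.trans h1) h2 (hz d' h1) (hz d hd.1) hd.2.1
    refine ⟨h1, fun t ht => (hcmp t ht.le).trans_lt (hd.2.1 t ht), ?_⟩
    refine tendsto_of_tendsto_of_tendsto_of_le_of_le' tendsto_const_nhds hd.2.2 ?_ ?_
    · filter_upwards [eventually_ge_atTop 0] with t ht
      exact (hz d' h1).1.2.1 t (by linarith)
    · filter_upwards [eventually_ge_atTop 0] with t ht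
      exact hcmp t ht
  -- no maximum
  have hopen : ∀ d ∈ D, ∃ d' ∈ D, d < d' := by
    intro d hd
    have hd0 : 0 < d := hc.trans hd.1
    obtain ⟨q, hq0, hq1, hq⟩ := aux_small hg (ε := c / (d + 1)) (by positivity)
    have hq' : (d + 1) * g q < c * q := by
      rw [div_mul_eq_mul_div, lt_div_iff₀ (by linarith)] at hq
      linarith
    have hgq0 := aux_pos hg hq0 hq1.le
    obtain ⟨T, hT⟩ := eventually_atTop.1 (hd.2.2.eventually (gt_mem_nhds (half_pos hq0)))
    obtain ⟨N, hN⟩ := exists_nat_ge T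
    obtain ⟨m, hm1, hm⟩ := aux_max (hz d hd.1) hd.2.1 N
    obtain ⟨δ, hδ, hdep⟩ := aux_dep hg hc hd.1 hz hd.2.1 N (min (q/2) ((1-m)/2))
      (lt_min (by linarith) (by linarith))
    obtain ⟨d', hd'⟩ : ∃ d', d' = d + min δ 1 / 2 := ⟨_, rfl⟩
    have hmin : 0 < min δ 1 := lt_min hδ one_pos
    have h1 : d < d' := by linarith
    have h2 : d' < d + δ := by linarith [min_le_left δ 1]
    have h3 : d' < d + 1 := by linarith [min_le_right δ 1]
    have hcd' : c < d' := hd.1.trans h1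
    have hsol := hz d' hcd'
    have hd'0 : 0 < d' := hc.trans hcd'
    have hN0 : (0:ℝ) ≤ N := Nat.cast_nonneg N
    have hdg : d' * g q < c * q := by nlinarith
    have hle := hdep d' h1 h2
    have hm1' := min_le_left (q/2) ((1-m)/2)
    have hm2' := min_le_right (q/2) ((1-m)/2)
    have hf : ∀ t ∈ Icc (N:ℝ) (N+1), z d' t ≤ q := by
      intro t ht
      have := hle t ⟨by linarith [ht.1], ht.2⟩
      have := hT t (by linarith [ht.1])
      linarith
    refine ⟨d', ⟨hcd', fun t ht => ?_, aux_decay hg hc hd'0 hsol hN0 hq0 hq1 hdg hf⟩, h1⟩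
    rcases le_or_gt t 1 with h4 | h4
    · rw [hsol.2 t ⟨ht.le, h4⟩, Real.exp_lt_one_iff]; nlinarith
    · rcases le_or_gt t (N+1) with h5 | h5
      · have := hle t ⟨ht.le, h5⟩
        have := hm t ⟨h4.le, h5⟩
        linarith
      · exact (aux_stay hg hc hd'0 hsol hN0 hq0 hq1 hdg hq0 le_rfl hf t
          (by linarith)).trans_lt hq1
  obtain ⟨d0, hd0⟩ := hne
  refine ⟨sSup D, hd0.1.trans_le (le_csSup hbdd hd0), ?_⟩
  ext d
  constructor
  · intro hd
    obtain ⟨d', hd', hlt⟩ := hopen d hd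
    exact ⟨hd.1, hlt.trans_le (le_csSup hbdd hd')⟩
  · intro hd
    obtain ⟨d', hd', hlt⟩ := exists_lt_of_lt_csSup ⟨d0, hd0⟩ hd.2
    exact hdown d' hd' d hd.1 hlt.le
end
end

section
/- Assume condition (C_g)(a), c > 0, and let d > d* be fixed; choose d₀ ∈ (d*, d) and let τ₀ ∈ (1,∞) be the first time with z^{d₀}(τ₀) = 1, and set w⁰ := z^{d₀}. Let τ₁ := 1 + (1/c)·ln((d/c)(1−e^{−c}) + e^{−c}), and let w¹ : [0,∞) → ℝ be the solution of (E_g) with parameter d whose initial segment is w¹(t) = (d/c)(1−e^{−c·t}) + e^{−c·t} for 0 ≤ t ≤ 1. Let x⁺ be as in the standing definition. Then: (i) if t* ∈ ℝ and ω > 0 are such that x⁺(t*) = 1 and x⁺(t) < 1 for all t ∈ (t*, t*+ω), then ω ≤ τ₀ and x⁺(t*+t) ≥ w⁰(t) for all t ∈ [0, ω]; (ii) if t* ∈ ℝ and ω > 0 are such that x⁺(t*) = 1 and x⁺(t) > 1 for all t ∈ (t*, t*+ω), then ω ≤ τ₁ and x⁺(t*+t) ≤ w¹(t) for all t ∈ [0,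 ω]. -/
open Real Set Filter Topology MeasureTheory

noncomputable section

theorem aux_shift {a b : ℝ} {F x : ℝ → ℝ} (h : IsSolR a b F x) (T : ℝ) :
    IsSolR a b F (fun t => x (T + t)) := by
  obtain ⟨h1, h2, h3⟩ := h
  refine ⟨by fun_prop, fun t => h2 _, fun τ t ht => ?_⟩
  obtain ⟨hi, he⟩ := h3 (T + τ) (T + t) (by linarith)
  have e : (fun s => Real.exp (-a * (t - s)) * F (x (T + (s - 1)))) =
      fun s => (fun s => Real.exp (-a * (T + t - s)) * F (x (s - 1))) (T + s) := by
    funext s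
    simp only
    congr 2
    · ring
    · congr 1; ring
  constructor
  · have := hi.comp_add_left T
    simp only [add_sub_cancel_left] at this
    rw [e]; exact this
  · have e2 := intervalIntegral.integral_comp_add_left (a := τ) (b := t)
      (fun s => Real.exp (-a * (T + t - s)) * F (x (s - 1))) T
    rw [e, e2]
    have e3 : T + t - (T + τ) = t - τ := by ring
    rw [e3] at he
    exact he

theorem aux_mono_s13 {g g' : ℝ → ℝ} (hg : CgA g g') : MonotoneOn g (Icc (0:ℝ) 1) := by
  apply monotoneOn_of_hasDerivWithinAt_nonneg (f' := g') (convex_Icc 0 1)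
    (fun x hx => (hg.hasDeriv x hx).continuousWithinAt)
  · intro x hx
    exact (hg.hasDeriv x (interior_subset hx)).mono interior_subset
  · intro x hx
    rw [interior_Icc] at hx
    have := hg.slope x hx.1 hx.2.le
    have h2 : 0 ≤ g x / x := div_nonneg (hg.maps_to x hx.1.le).1 hx.1.le
    linarith

theorem aux_int (c t : ℝ) (hc : 0 < c) :
    ∫ s in (0:ℝ)..t, Real.exp (-c * (t - s)) = (1 - Real.exp (-c * t)) / c := by
  have : ∀ s ∈ uIcc 0 t, HasDerivAt (fun s => Real.exp (-c * (t - s)) / c)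
      (Real.exp (-c * (t - s))) s := by
    intro s _
    have h1 : HasDerivAt (fun s => -c * (t - s)) c s := by
      have := ((hasDerivAt_id s).const_sub t).const_mul (-c)
      simpa using this
    have := h1.exp.div_const c
    rwa [mul_div_assoc, div_self hc.ne', mul_one] at this
  rw [intervalIntegral.integral_eq_sub_of_hasDerivAt this
    (by apply Continuous.intervalIntegrable; fun_prop)]
  simp
  ring

/-- growth lower bound -/
theorem aux_low {a b τ t : ℝ} {F x : ℝ → ℝ} (hb : 0 ≤ b) (ht : τ < t)
    (hF : ∀ s, τ ≤ s → 0 ≤ F (x (s - 1)))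
    (h : x t = Real.exp (-a * (t - τ)) * x τ
          + b * ∫ s in τ..t, Real.exp (-a * (t - s)) * F (x (s - 1))) :
    Real.exp (-a * (t - τ)) * x τ ≤ x t := by
  rw [h]
  have : 0 ≤ ∫ s in τ..t, Real.exp (-a * (t - s)) * F (x (s - 1)) :=
    intervalIntegral.integral_nonneg ht.le fun s hs =>
      mul_nonneg (Real.exp_pos _).le (hF s hs.1)
  nlinarith [mul_nonneg hb this]

theorem aux_one {c d d₀ : ℝ} {g g' : ℝ → ℝ} (hg : CgA g g') (hc : 0 < c) (hd₀ : c < d₀)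
    (hd : d₀ < d) {z y : ℝ → ℝ} (hz : IsZSol c d₀ g z) (hy : IsSolR c d g y)
    {τ₀ ω : ℝ} (hfirst : ∀ t : ℝ, 0 < t → t < τ₀ → z t < 1)
    (hy0 : y 0 = 1) (hyl : ∀ t, 0 < t → t < ω → y t < 1) (n : ℕ) :
    ∀ t : ℝ, 0 ≤ t → t ≤ n + 1 → t ≤ τ₀ → t ≤ ω → z t ≤ y t := by
  have base : ∀ t, 0 ≤ t → t ≤ 1 → z t ≤ y t := by
    intro t h0 h1
    rw [hz.2 t ⟨h0, h1⟩]
    rcases h0.eq_or_lt with rfl | h0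
    · simp [hy0]
    · have := aux_low (by linarith : 0 ≤ d) h0 (fun s _ => (hg.maps_to _ (hy.2.1 _)).1)
        (hy.2.2 0 t h0).2
      simpa [hy0] using this
  induction n with
  | zero => intro t h0 h1 _ _; exact base t h0 (by simpa using h1)
  | succ n ih =>
    intro t h0 h1 h2 h3
    push_cast at h1
    rcases le_or_gt t 1 with h | h
    · exact base t h0 h
    obtain ⟨zi, ze⟩ := hz.1.2.2 1 t le_rfl h
    obtain ⟨yi, ye⟩ := hy.2.2 1 t h
    rw [ze, ye]
    have hz0 : ∀ s, 0 ≤ s → 0 ≤ z s := fun s hs => hz.1.2.1 s (by linarith)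
    have hI : ∫ s in (1:ℝ)..t, Real.exp (-c * (t - s)) * g (z (s - 1)) ≤
        ∫ s in (1:ℝ)..t, Real.exp (-c * (t - s)) * g (y (s - 1)) := by
      apply intervalIntegral.integral_mono_on h.le zi yi
      intro s hs
      apply mul_le_mul_of_nonneg_left _ (Real.exp_pos _).le
      have hzy := ih (s - 1) (by linarith [hs.1]) (by linarith [hs.2]) (by linarith [hs.2])
        (by linarith [hs.2])
      have hz1 : 0 ≤ z (s - 1) := hz0 _ (by linarith [hs.1])
      have hy1 : y (s - 1) ≤ 1 := by
        rcases hs.1.eq_or_lt with e | e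
        · rw [← e]; simp [hy0]
        · exact (hyl _ (by linarith) (by linarith [hs.2])).le
      exact aux_mono_s13 hg ⟨hz1, hzy.trans hy1⟩ ⟨hz1.trans hzy, hy1⟩ hzy
    have hI0 : 0 ≤ ∫ s in (1:ℝ)..t, Real.exp (-c * (t - s)) * g (z (s - 1)) :=
      intervalIntegral.integral_nonneg h.le fun s hs =>
        mul_nonneg (Real.exp_pos _).le (hg.maps_to _ (hz0 _ (by linarith [hs.1]))).1
    have hb := mul_le_mul_of_nonneg_left (base 1 zero_le_one le_rfl)
      (Real.exp_pos (-c * (t - 1))).le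
    have := mul_le_mul hd.le hI hI0 (by linarith)
    linarith

theorem aux_two {c d : ℝ} {g g' : ℝ → ℝ} (hg : CgA g g') (hc : 0 < c) (hd : c < d)
    {y : ℝ → ℝ} (hy : IsSolR c d g y) {ω : ℝ}
    (hy0 : y 0 = 1) (hyl : ∀ t, 0 < t → t < ω → 1 < y t) :
    (∀ t, 0 ≤ t → t ≤ 1 → y t ≤ (d / c) * (1 - Real.exp (-c * t)) + Real.exp (-c * t)) ∧
    (∀ t, 1 < t → t ≤ ω → y t = Real.exp (-c * (t - 1)) * y 1) := by
  constructor
  · intro t h0 _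
    rcases h0.eq_or_lt with rfl | h0
    · simp [hy0]
    obtain ⟨yi, ye⟩ := hy.2.2 0 t h0
    have hI : ∫ s in (0:ℝ)..t, Real.exp (-c * (t - s)) * g (y (s - 1)) ≤
        ∫ s in (0:ℝ)..t, Real.exp (-c * (t - s)) := by
      apply intervalIntegral.integral_mono_on h0.le yi
        (by apply Continuous.intervalIntegrable; fun_prop)
      intro s hs
      exact mul_le_of_le_one_right (Real.exp_pos _).le (hg.maps_to _ (hy.2.1 _)).2
    rw [aux_int c t hc] at hI
    have := mul_le_mul_of_nonneg_left hI (by linarith : 0 ≤ d)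
    rw [ye, hy0]
    have e : d * ((1 - Real.exp (-c * t)) / c) = (d / c) * (1 - Real.exp (-c * t)) := by ring
    simp only [sub_zero, mul_one] at *
    linarith
  · intro t h1 h2
    obtain ⟨yi, ye⟩ := hy.2.2 1 t h1
    have : ∫ s in (1:ℝ)..t, Real.exp (-c * (t - s)) * g (y (s - 1)) = 0 := by
      apply intervalIntegral.integral_zero_ae
      refine Eventually.of_forall fun s hs => ?_
      rw [uIoc_of_le h1.le] at hs
      rw [hg.eq_zero _ (hyl _ (by linarith [hs.1]) (by linarith [hs.2])), mul_zero]
    rw [ye, this]; ring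

/-- envelope estimates for `x⁺` by `w⁰ = z^{d₀}` on excursions below `1`
and by `w¹` on excursions above `1`. -/
theorem stmt_13 (c d dstar d₀ : ℝ) (g g' : ℝ → ℝ) (hg : CgA g g') (hc : 0 < c)
    (z : ℝ → ℝ → ℝ) (hz : ∀ e : ℝ, c < e → IsZSol c e g (z e))
    (hds : c < dstar)
    (hD : {e : ℝ | c < e ∧ (∀ t : ℝ, 0 < t → z e t < 1) ∧ Tendsto (z e) atTop (nhds 0)}
        = Ioo c dstar)
    (hd : dstar < d) (hd₀ : dstar < d₀ ∧ d₀ < d)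
    (τ₀ : ℝ) (hτ₀ : 1 < τ₀)
    (hfirst : ∀ t : ℝ, 0 < t → t < τ₀ → z d₀ t < 1) (hhit : z d₀ τ₀ = 1)
    (w1 : ℝ → ℝ) (hw1 : IsSolOn c d g 1 w1)
    (hw1init : ∀ t ∈ Icc (0:ℝ) 1,
        w1 t = (d / c) * (1 - Real.exp (-c * t)) + Real.exp (-c * t))
    (ξ₁ κp : ℝ) (hξ₁ : ξ₁ ∈ Ioo (0:ℝ) 1) (hz₁ : -c * ξ₁ + d * g ξ₁ = 0)
    (hκp : κp ∈ Ioo 0 (1 - ξ₁))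
    (xp : ℝ → ℝ) (hxp : IsSolR c d g xp) (hxp0 : xp 0 = ξ₁ + κp)
    (hxpb : ∀ t : ℝ, t ≤ 0 → ξ₁ ≤ xp t ∧ xp t ≤ xp 0) :
    (∀ tstar ω : ℝ, 0 < ω → xp tstar = 1 →
      (∀ t : ℝ, tstar < t → t < tstar + ω → xp t < 1) →
      ω ≤ τ₀ ∧ ∀ t ∈ Icc (0:ℝ) ω, z d₀ t ≤ xp (tstar + t)) ∧
    (∀ tstar ω : ℝ, 0 < ω → xp tstar = 1 →
      (∀ t : ℝ, tstar < t → t < tstar + ω → 1 < xp t) →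
      ω ≤ 1 + (1 / c) * Real.log ((d / c) * (1 - Real.exp (-c)) + Real.exp (-c)) ∧
      ∀ t ∈ Icc (0:ℝ) ω, xp (tstar + t) ≤ w1 t) := by
  have hcd : c < d := hds.trans hd
  constructor
  · intro T ω hω hT hl
    have hy := aux_shift hxp T
    have key := aux_one hg hc (hds.trans hd₀.1) hd₀.2 (hz d₀ (hds.trans hd₀.1)) hy
      (ω := ω) hfirst (by simpa using hT)
      (fun t h0 h1 => hl (T + t) (by linarith) (by linarith))
    have key' : ∀ t, 0 ≤ t → t ≤ τ₀ → t ≤ ω → z d₀ t ≤ xp (T + t) := by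
      intro t h0 h1 h2
      obtain ⟨n, hn⟩ := exists_nat_ge t
      exact key n t h0 (by linarith) h1 h2
    have hle : ω ≤ τ₀ := by
      by_contra! h
      have h1 := key' τ₀ (by linarith) le_rfl h.le
      have h2 := hl (T + τ₀) (by linarith) (by linarith)
      linarith
    exact ⟨hle, fun t ht => key' t ht.1 (ht.2.trans hle) ht.2⟩
  · intro T ω hω hT hl
    have hy := aux_shift hxp T
    obtain ⟨k1, k2⟩ := aux_two hg hc hcd hy (ω := ω) (by simpa using hT)
      (fun t h0 h1 => hl (T + t) (by linarith) (by linarith))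
    have hW := k1 1 zero_le_one le_rfl
    simp only [mul_one] at hW
    constructor
    · by_contra! h
      set W := (d / c) * (1 - Real.exp (-c)) + Real.exp (-c) with hWd
      have hW1 : 1 < W := by
        have h1 : 1 < d / c := (one_lt_div hc).2 hcd
        have h2 : Real.exp (-c) < 1 := Real.exp_lt_one_iff.2 (by linarith)
        nlinarith
      have hlog : 0 < Real.log W := Real.log_pos hW1
      have hq : 0 < 1 / c * Real.log W := by positivity
      have h1 := k2 (1 + 1 / c * Real.log W) (by linarith) h.le
      have h2 := hl (T + (1 + 1 / c * Real.log W)) (by linarith) (by linarith)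
      have e : -c * (1 + 1 / c * Real.log W - 1) = -Real.log W := by field_simp; ring
      rw [h1, e, Real.exp_neg, Real.exp_log (by linarith)] at h2
      have : W⁻¹ * xp (T + 1) ≤ W⁻¹ * W :=
        mul_le_mul_of_nonneg_left hW (by positivity)
      rw [inv_mul_cancel₀ (by linarith)] at this
      linarith
    · intro t ht
      rcases le_or_gt t 1 with h | h
      · rw [hw1init t ⟨ht.1, h⟩]; exact k1 t ht.1 h
      · rw [k2 t h ht.2]
        have h3 := aux_low (by linarith : 0 ≤ d) h
          (fun s hs => (hg.maps_to _ (hw1.2.1 _ (by linarith))).1) (hw1.2.2 1 t le_rfl h).2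
        refine le_trans (mul_le_mul_of_nonneg_left ?_ (Real.exp_pos _).le) h3
        rw [hw1init 1 ⟨zero_le_one, le_rfl⟩, mul_one]
        exact hW
end
end

section
/- Assume condition (C_g)(a), c > 0, and d ∈ (c, d*). Let x⁺ be as in the standing definition and t₂ the second time with x⁺(t₂) = 1. Then x⁺(t₂ + t) = z^d(t) for all t ≥ 0; consequently x⁺(t) < 1 for all t > t₂ and x⁺(t) → 0 as t → ∞. -/
open Real Set Filter Topology MeasureTheory

noncomputable section

/-- for `d ∈ (c, d*)`, after time `t₂` the solution `x⁺` coincides with the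
translate of `z^d`, stays below `1`, and tends to `0`. -/
theorem stmt_15 (c d dstar : ℝ) (g g' : ℝ → ℝ) (hg : CgA g g') (hc : 0 < c)
    (z : ℝ → ℝ → ℝ) (hz : ∀ e : ℝ, c < e → IsZSol c e g (z e))
    (hds : c < dstar)
    (hD : {e : ℝ | c < e ∧ (∀ t : ℝ, 0 < t → z e t < 1) ∧ Tendsto (z e) atTop (nhds 0)}
        = Ioo c dstar)
    (hd : c < d ∧ d < dstar)
    (ξ₁ κp : ℝ) (hξ₁ : ξ₁ ∈ Ioo (0:ℝ) 1) (hz₁ : -c * ξ₁ + d * g ξ₁ = 0)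
    (hκp : κp ∈ Ioo 0 (1 - ξ₁))
    (xp : ℝ → ℝ) (hxp : IsSolR c d g xp) (hxp0 : xp 0 = ξ₁ + κp)
    (hxpb : ∀ t : ℝ, t ≤ 0 → ξ₁ ≤ xp t ∧ xp t ≤ xp 0)
    (t₁ t₂ : ℝ) (ht₁ : 0 < t₁) (hxt₁ : xp t₁ = 1)
    (hmono : StrictMonoOn xp (Iic (t₁ + 1)))
    (ht₂ : t₂ = t₁ + 1 + (1 / c) * Real.log (xp (t₁ + 1))) (hxt₂ : xp t₂ = 1)
    (hinit : ∀ s ∈ Icc (0:ℝ) 1, xp (t₂ + s) = Real.exp (-c * s)) :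
    (∀ t : ℝ, 0 ≤ t → xp (t₂ + t) = z d t) ∧
    (∀ t : ℝ, t₂ < t → xp t < 1) ∧
    Tendsto xp atTop (nhds 0) := by
  have hzd := hz d hd.1
  obtain ⟨⟨-, -, hzeq⟩, hzi⟩ := hzd
  obtain ⟨-, -, hxeq⟩ := hxp
  have key : ∀ n : ℕ, ∀ t : ℝ, 0 ≤ t → t ≤ (n : ℝ) + 1 → xp (t₂ + t) = z d t := by
    intro n
    induction n with
    | zero =>
      intro t h0 h1
      have h1' : t ≤ 1 := by simpa using h1
      rw [hinit t ⟨h0, h1'⟩, hzi t ⟨h0, h1'⟩]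
    | succ k ih =>
      intro t h0 h1
      rcases le_or_gt t 1 with h | h
      · rw [hinit t ⟨h0, h⟩, hzi t ⟨h0, h⟩]
      · rw [(hzeq 1 t le_rfl h).2, (hxeq (t₂ + 1) (t₂ + t) (by linarith)).2]
        have e1 : xp (t₂ + 1) = z d 1 := ih 1 (by norm_num) (by simp)
        have e2 : (∫ s in (t₂ + 1)..(t₂ + t), Real.exp (-c * (t₂ + t - s)) * g (xp (s - 1)))
            = ∫ s in (1:ℝ)..t, Real.exp (-c * (t - s)) * g (z d (s - 1)) := by
          rw [← intervalIntegral.integral_comp_add_left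
            (fun s => Real.exp (-c * (t₂ + t - s)) * g (xp (s - 1))) t₂]
          apply intervalIntegral.integral_congr
          intro s hs
          rw [Set.uIcc_of_le h.le] at hs
          have e3 : xp (t₂ + (s - 1)) = z d (s - 1) := by
            apply ih
            · linarith [hs.1]
            · push_cast at h1
              linarith [hs.2]
          have e4 : t₂ + s - 1 = t₂ + (s - 1) := by ring
          have e5 : t₂ + t - (t₂ + s) = t - s := by ring
          simp only [e4, e5, e3]
        have e6 : t₂ + t - (t₂ + 1) = t - 1 := by ring
        rw [e1, e2, e6]
  have main : ∀ t : ℝ, 0 ≤ t → xp (t₂ + t) = z d t := by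
    intro t ht
    obtain ⟨n, hn⟩ := exists_nat_ge t
    exact key n t ht (by linarith)
  have hmem : d ∈ {e : ℝ | c < e ∧ (∀ t : ℝ, 0 < t → z e t < 1) ∧
      Tendsto (z e) atTop (nhds 0)} := by
    rw [hD]
    exact hd
  obtain ⟨-, hlt, hlim⟩ := hmem
  refine ⟨main, ?_, ?_⟩
  · intro t ht
    have h := main (t - t₂) (by linarith)
    rw [add_sub_cancel] at h
    rw [h]
    exact hlt _ (by linarith)
  · have h1 : Tendsto (fun t : ℝ => z d (t - t₂)) atTop (nhds 0) :=
      hlim.comp (tendsto_atTop_add_const_right atTop (-t₂) tendsto_id)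
    refine h1.congr' ?_
    filter_upwards [eventually_ge_atTop t₂] with t ht
    have h := main (t - t₂) (by linarith)
    rw [add_sub_cancel] at h
    exact h.symm
end
end
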